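/- There exists a constant C > 0 such that for every integer n ≥ 4 there is a set V of n points on the unit sphere S² ⊆ ℝ³ whose number of double-normal pairs satisfies N(V) ≥ (17/4)n − C·√n. -/

import Mathlib

open scoped RealInnerProductSpace Classical

noncomputable section

abbrev Euc (d : ℕ) : Type := EuclideanSpace ℝ (Fin d)

/-- `{p, q}` is a double-normal pair of the finite point set `V`. -/
def IsDNPair {d : ℕ} (V : Finset (Euc d)) (p q : Euc d) : Prop :=
  p ∈ V ∧ q ∈ V ∧ p ≠ q ∧
    ∀ v ∈ V, 0 ≤ ⟪v - p, q - p⟫ ∧ 0 ≤ ⟪v - q, p - q⟫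

/-- `N(V)`: the number of (unordered) double-normal pairs of `V`. -/
def numDN {d : ℕ} (V : Finset (Euc d)) : ℕ :=
  ((V ×ˢ V).filter fun pq => IsDNPair V pq.1 pq.2).card / 2

/-- `{p, q}` is a strict double-normal pair of `V`. -/
def IsStrictDNPair {d : ℕ} (V : Finset (Euc d)) (p q : Euc d) : Prop :=
  IsDNPair V p q ∧
    ∀ v ∈ V, v ≠ p → v ≠ q → 0 < ⟪v - p, q - p⟫ ∧ 0 < ⟪v - q, p - q⟫

/-- `N'(V)`: the number of (unordered) strict double-normal pairs of `V`. -/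
def numStrictDN {d : ℕ} (V : Finset (Euc d)) : ℕ :=
  ((V ×ˢ V).filter fun pq => IsStrictDNPair V pq.1 pq.2).card / 2


set_option linter.all false

open Filter Topology

/-! ### Removing points -/

def dnF (V : Finset (Euc 3)) : Finset (Euc 3 × Euc 3) :=
  (V ×ˢ V).filter fun pq => IsDNPair V pq.1 pq.2

lemma mem_dnF (V : Finset (Euc 3)) (pq : Euc 3 × Euc 3) :
    pq ∈ dnF V ↔ IsDNPair V pq.1 pq.2 := by
  unfold dnF
  rw [Finset.mem_filter, Finset.mem_product]
  exact ⟨fun h => h.2, fun h => ⟨⟨h.1, h.2.1⟩, h⟩⟩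

lemma dn_erase (V : Finset (Euc 3)) (v : Euc 3) :
    ((dnF V).filter fun pq => v ≠ pq.1 ∧ v ≠ pq.2).card ≤ (dnF (V.erase v)).card := by
  apply Finset.card_le_card
  intro pq h
  rw [Finset.mem_filter, mem_dnF] at h
  rw [mem_dnF]
  obtain ⟨⟨h3, h4, h5, h6⟩, h7, h8⟩ := h
  exact ⟨Finset.mem_erase.2 ⟨h7.symm, h3⟩, Finset.mem_erase.2 ⟨h8.symm, h4⟩, h5,
    fun w hw => h6 w (Finset.mem_of_mem_erase hw)⟩

lemma dn_sum (V : Finset (Euc 3)) :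
    (V.card - 2) * (dnF V).card ≤ ∑ v ∈ V, (dnF (V.erase v)).card := by
  have h1 : ∑ v ∈ V, ((dnF V).filter fun pq => v ≠ pq.1 ∧ v ≠ pq.2).card
      = ∑ pq ∈ dnF V, (V.filter fun v => v ≠ pq.1 ∧ v ≠ pq.2).card :=
    Finset.sum_card_bipartiteAbove_eq_sum_card_bipartiteBelow
      (fun v (pq : Euc 3 × Euc 3) => v ≠ pq.1 ∧ v ≠ pq.2)
  have h2 : ∀ pq ∈ dnF V, V.card - 2 ≤ (V.filter fun v => v ≠ pq.1 ∧ v ≠ pq.2).card := by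
    intro pq _
    have : V.filter (fun v => v ≠ pq.1 ∧ v ≠ pq.2) = V \ {pq.1, pq.2} := by
      ext v; simp
    rw [this]
    have h3 := Finset.le_card_sdiff {pq.1, pq.2} V
    have h4 : ({pq.1, pq.2} : Finset (Euc 3)).card ≤ 2 := Finset.card_le_two
    omega
  calc (V.card - 2) * (dnF V).card = ∑ pq ∈ dnF V, (V.card - 2) := by
        rw [Finset.sum_const, smul_eq_mul, mul_comm]
    _ ≤ ∑ pq ∈ dnF V, (V.filter fun v => v ≠ pq.1 ∧ v ≠ pq.2).card := Finset.sum_le_sum h2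
    _ = _ := h1.symm
    _ ≤ _ := Finset.sum_le_sum fun v _ => dn_erase V v

lemma dn_remove (V : Finset (Euc 3)) (n : ℕ) (hn : 2 ≤ n) (hV : V.card = n) (L : ℝ) (hL : 0 ≤ L)
    (h : 17 / 2 * (n : ℝ) - L ≤ (dnF V).card) :
    ∃ v ∈ V, 17 / 2 * ((n : ℝ) - 1) - (L + 17 / 2) ≤ (dnF (V.erase v)).card := by
  by_contra hc
  push Not at hc
  have hne : V.Nonempty := by
    rw [← Finset.card_pos]; omega
  have h1 : ∑ v ∈ V, ((dnF (V.erase v)).card : ℝ)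
      < ∑ v ∈ V, (17 / 2 * ((n : ℝ) - 1) - (L + 17 / 2)) :=
    Finset.sum_lt_sum_of_nonempty hne hc
  rw [Finset.sum_const, hV, nsmul_eq_mul] at h1
  have h2 : (((n - 2 : ℕ) * (dnF V).card : ℕ) : ℝ) ≤ ∑ v ∈ V, ((dnF (V.erase v)).card : ℝ) := by
    have := dn_sum V
    rw [hV] at this
    exact_mod_cast this
  rw [Nat.cast_mul, Nat.cast_sub hn] at h2
  have hn' : (2 : ℝ) ≤ n := by exact_mod_cast hn
  push_cast at h2
  nlinarith [mul_le_mul_of_nonneg_left h (sub_nonneg.2 hn')]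

lemma dn_shrink (n : ℕ) (hn : 2 ≤ n) (j : ℕ) : ∀ (V : Finset (Euc 3)) (_ : V.card = n + j) (L : ℝ)
    (_ : 0 ≤ L) (_ : 17 / 2 * ((n : ℝ) + j) - L ≤ (dnF V).card),
    ∃ W ⊆ V, W.card = n ∧ 17 / 2 * (n : ℝ) - (L + 17 / 2 * j) ≤ (dnF W).card := by
  induction j with
  | zero =>
    intro V hV L hL h
    refine ⟨V, subset_rfl, by simpa using hV, ?_⟩
    simpa using h
  | succ j ih =>
    intro V hV L hL h
    obtain ⟨v, hv, h'⟩ := dn_remove V (n + (j + 1)) (by omega) hV L hL (by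
      push_cast at h ⊢; linarith)
    obtain ⟨W, hW, hW1, hW2⟩ := ih (V.erase v) (by
      rw [Finset.card_erase_of_mem hv, hV]; rfl) (L + 17 / 2) (by linarith) (by
        push_cast at h' ⊢; linarith)
    refine ⟨W, hW.trans (Finset.erase_subset _ _), hW1, ?_⟩
    push_cast at hW2 ⊢; linarith

/-- The final reduction. -/
lemma main_of_family
    (fam : ∀ K : ℕ, 1 ≤ K → ∃ V : Finset (Euc 3), (∀ v ∈ V, ‖v‖ = 1) ∧ V.card = 8 * K ^ 2 ∧
      68 * (K - 1) ^ 2 ≤ (dnF V).card) :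
    ∃ C : ℝ, 0 < C ∧ ∀ n : ℕ, 4 ≤ n →
      ∃ V : Finset (Euc 3), (∀ v ∈ V, ‖v‖ = 1) ∧ V.card = n ∧
        17 / 4 * (n : ℝ) - C * Real.sqrt n ≤ (numDN V : ℝ) := by
  refine ⟨200, by norm_num, fun n hn => ?_⟩
  have hex : ∃ K : ℕ, n ≤ 8 * K ^ 2 := ⟨n, by nlinarith⟩
  set K := Nat.find hex with hK
  have hK1 : n ≤ 8 * K ^ 2 := Nat.find_spec hex
  have hKpos : 1 ≤ K := by
    by_contra h0
    have : K = 0 := by omega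
    rw [this] at hK1
    omega
  obtain ⟨k, hk⟩ : ∃ k, K = k + 1 := ⟨K - 1, by omega⟩
  have hk2 : 8 * k ^ 2 < n := by
    have := Nat.find_min hex (m := k) (by omega)
    omega
  obtain ⟨V, hV1, hV2, hV3⟩ := fam K hKpos
  rw [hk] at hV2 hV3 hK1
  simp only [Nat.add_sub_cancel] at hV3
  obtain ⟨j, hj⟩ : ∃ j, 8 * (k + 1) ^ 2 = n + j := ⟨8 * (k + 1) ^ 2 - n, by omega⟩
  have hj' : j ≤ 16 * k + 8 := by nlinarith
  have hjR : (j : ℝ) ≤ 16 * k + 8 := by exact_mod_cast hj'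
  have hjE : 8 * ((k : ℝ) + 1) ^ 2 = n + j := by exact_mod_cast hj
  have hV3' : 68 * (k : ℝ) ^ 2 ≤ (dnF V).card := by exact_mod_cast hV3
  obtain ⟨W, hW, hW1, hW2⟩ := dn_shrink n (by omega) j V (by rw [hV2, hj])
    (136 * (k + 1)) (by positivity) (by
      rw [← hjE]; nlinarith)
  refine ⟨W, fun v hv => hV1 v (hW hv), hW1, ?_⟩
  have hkn : (k : ℝ) + 1 ≤ Real.sqrt n := by
    apply Real.le_sqrt_of_sq_le
    have h4 : (4 : ℝ) ≤ n := by exact_mod_cast hn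
    have h5 : 8 * (k : ℝ) ^ 2 < n := by exact_mod_cast hk2
    rcases Nat.eq_zero_or_pos k with h0 | h0
    · rw [h0]; norm_num; linarith
    · have : (1 : ℝ) ≤ k := by exact_mod_cast h0
      nlinarith
  have hfl : ((dnF W).card : ℝ) - 1 ≤ 2 * (numDN W : ℝ) := by
    have : (dnF W).card ≤ 2 * numDN W + 1 := by
      unfold numDN dnF
      omega
    have : ((dnF W).card : ℝ) ≤ 2 * numDN W + 1 := by exact_mod_cast this
    linarith
  nlinarith
/-! ### Scaled coordinates on the sphere -/

structure T3 where
  x : ℝ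
  y : ℝ
  h : ℝ

/-- scaled inner product `(l - i) · (l - j)` -/
def G (t : ℝ) (i j l : T3) : ℝ :=
  (l.x - i.x) * (l.x - j.x) + (l.y - i.y) * (l.y - j.y) + t * ((l.h - i.h) * (l.h - j.h))

def OnQ (t : ℝ) (a : T3) : Prop := a.x ^ 2 + a.y ^ 2 + t * a.h ^ 2 = 2 * a.h

def para (a b c : T3) : T3 := ⟨a.x + b.x - c.x, a.y + b.y - c.y, a.h + b.h - c.h⟩

def dif (a b : T3) : T3 := ⟨a.x - b.x, a.y - b.y, a.h - b.h⟩

def sα (t d : ℝ) (q f : T3) : ℝ := q.y - (f.x * (d - q.x) - t * f.h * q.h) / f.y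
def sβ (c : ℝ) (f : T3) : ℝ := (c * f.x - f.h) / f.y
def sA (t c : ℝ) (f : T3) : ℝ := t * (1 + c ^ 2 * t + sβ c f ^ 2 * t)
def sB (t c d : ℝ) (q f : T3) : ℝ := 1 + c * t * d - t * sα t d q f * sβ c f
def sC (t d : ℝ) (q f : T3) : ℝ := d ^ 2 + sα t d q f ^ 2
def sH (t c d : ℝ) (q f : T3) : ℝ :=
  sC t d q f / (sB t c d q f + √(sB t c d q f ^ 2 - sA t c f * sC t d q f))

def sol (t c d : ℝ) (q f : T3) : T3 :=
  ⟨d - c * t * sH t c d q f, sα t d q f + t * sβ c f * sH t c d q f, sH t c d q f⟩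

lemma sol_spec (t c d : ℝ) (q f : T3) (hf : f.y ≠ 0) (hB : 0 < sB t c d q f)
    (hD : 0 ≤ sB t c d q f ^ 2 - sA t c f * sC t d q f) :
    OnQ t (sol t c d q f) ∧ (sol t c d q f).x + c * t * (sol t c d q f).h = d ∧
    f.x * ((sol t c d q f).x - q.x) + f.y * ((sol t c d q f).y - q.y)
      + t * (f.h * ((sol t c d q f).h - q.h)) = 0 := by
  refine ⟨?_, by simp [sol], ?_⟩
  · have hs := Real.sq_sqrt hD
    have hs0 := Real.sqrt_nonneg (sB t c d q f ^ 2 - sA t c f * sC t d q f)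
    have hH : sA t c f * sH t c d q f ^ 2 - 2 * sB t c d q f * sH t c d q f + sC t d q f = 0 := by
      unfold sH
      set s := √(sB t c d q f ^ 2 - sA t c f * sC t d q f)
      have : sB t c d q f + s ≠ 0 := by positivity
      field_simp
      linear_combination (sC t d q f) * hs
    simp only [OnQ, sol]
    generalize sH t c d q f = H at *
    simp only [sA, sB, sC] at hH
    linear_combination hH
  · simp only [sol, sβ, sα]
    field_simp
    ring

def Lim (P : ℝ → T3) (a : T3) : Prop :=
  Tendsto (fun t => (P t).x) (𝓝[>] 0) (𝓝 a.x) ∧ Tendsto (fun t => (P t).y) (𝓝[>] 0) (𝓝 a.y) ∧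
  Tendsto (fun t => (P t).h) (𝓝[>] 0) (𝓝 a.h)

lemma tend_t : Tendsto (fun t : ℝ => t) (𝓝[>] 0) (𝓝 0) :=
  tendsto_nhdsWithin_of_tendsto_nhds tendsto_id

lemma Lim.const (a : T3) : Lim (fun _ => a) a :=
  ⟨tendsto_const_nhds, tendsto_const_nhds, tendsto_const_nhds⟩

lemma Lim.para {P Q R : ℝ → T3} {a b c : T3} (hP : Lim P a) (hQ : Lim Q b) (hR : Lim R c) :
    Lim (fun t => para (P t) (Q t) (R t)) (para a b c) :=
  ⟨(hP.1.add hQ.1).sub hR.1, (hP.2.1.add hQ.2.1).sub hR.2.1, (hP.2.2.add hQ.2.2).sub hR.2.2⟩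

lemma Lim.dif {P Q : ℝ → T3} {a b : T3} (hP : Lim P a) (hQ : Lim Q b) :
    Lim (fun t => dif (P t) (Q t)) (dif a b) :=
  ⟨hP.1.sub hQ.1, hP.2.1.sub hQ.2.1, hP.2.2.sub hQ.2.2⟩

lemma Lim.G {P Q R : ℝ → T3} {a b c : T3} (hP : Lim P a) (hQ : Lim Q b) (hR : Lim R c) :
    Tendsto (fun t => G t (P t) (Q t) (R t)) (𝓝[>] 0) (𝓝 (G 0 a b c)) :=
  (((hR.1.sub hP.1).mul (hR.1.sub hQ.1)).add ((hR.2.1.sub hP.2.1).mul (hR.2.1.sub hQ.2.1))).add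
    (tend_t.mul ((hR.2.2.sub hP.2.2).mul (hR.2.2.sub hQ.2.2)))

lemma sol_lim (c : ℝ) {d : ℝ → ℝ} {d0 : ℝ} {q f : ℝ → T3} {q0 f0 : T3}
    (hd : Tendsto d (𝓝[>] 0) (𝓝 d0)) (hq : Lim q q0) (hf : Lim f f0) (hf0 : f0.y ≠ 0) :
    Lim (fun t => sol t c (d t) (q t) (f t)) (sol 0 c d0 q0 f0) ∧
    ∀ᶠ t in 𝓝[>] 0, (OnQ t (sol t c (d t) (q t) (f t)) ∧
      (sol t c (d t) (q t) (f t)).x + c * t * (sol t c (d t) (q t) (f t)).h = d t ∧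
      (f t).x * ((sol t c (d t) (q t) (f t)).x - (q t).x)
      + (f t).y * ((sol t c (d t) (q t) (f t)).y - (q t).y)
      + t * ((f t).h * ((sol t c (d t) (q t) (f t)).h - (q t).h)) = 0) := by
  have ht := tend_t
  have hα : Tendsto (fun t => sα t (d t) (q t) (f t)) (𝓝[>] 0) (𝓝 (sα 0 d0 q0 f0)) :=
    hq.2.1.sub (((hf.1.mul (hd.sub hq.1)).sub ((ht.mul hf.2.2).mul hq.2.2)).div hf.2.1 hf0)
  have hβ : Tendsto (fun t => sβ c (f t)) (𝓝[>] 0) (𝓝 (sβ c f0)) :=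
    ((hf.1.const_mul c).sub hf.2.2).div hf.2.1 hf0
  have hA : Tendsto (fun t => sA t c (f t)) (𝓝[>] 0) (𝓝 (sA 0 c f0)) :=
    ht.mul (((ht.const_mul (c ^ 2)).const_add 1).add ((hβ.pow 2).mul ht))
  have hB : Tendsto (fun t => sB t c (d t) (q t) (f t)) (𝓝[>] 0) (𝓝 (sB 0 c d0 q0 f0)) :=
    (((ht.const_mul c).mul hd).const_add 1).sub ((ht.mul hα).mul hβ)
  have hC : Tendsto (fun t => sC t (d t) (q t) (f t)) (𝓝[>] 0) (𝓝 (sC 0 d0 q0 f0)) :=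
    (hd.pow 2).add (hα.pow 2)
  have hD := (hB.pow 2).sub (hA.mul hC)
  have hB0 : sB 0 c d0 q0 f0 = 1 := by simp [sB]
  have hA0 : sA 0 c f0 = 0 := by simp [sA]
  have hH : Tendsto (fun t => sH t c (d t) (q t) (f t)) (𝓝[>] 0) (𝓝 (sH 0 c d0 q0 f0)) :=
    hC.div (hB.add hD.sqrt) (by rw [hB0, hA0]; norm_num)
  refine ⟨⟨hd.sub ((ht.const_mul c).mul hH), hα.add ((ht.mul hβ).mul hH), hH⟩, ?_⟩
  have e1 := hf.2.1.eventually_ne hf0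
  have e2 := hB.eventually_const_lt (u := 0) (by rw [hB0]; norm_num)
  have e3 := hD.eventually_const_lt (u := 0) (by rw [hB0, hA0]; norm_num)
  filter_upwards [e1, e2, e3] with t h1 h2 h3
  exact sol_spec t c (d t) (q t) (f t) h1 h2 h3.le

lemma sol_zero (c d : ℝ) (q f : T3) : sol 0 c d q f =
    ⟨d, q.y - f.x * (d - q.x) / f.y, (d ^ 2 + (q.y - f.x * (d - q.x) / f.y) ^ 2) / 2⟩ := by
  simp only [sol, sH, sA, sB, sC, sα]
  norm_num

/-! ### The right-triangle lemma -/

lemma gram (a1 a2 a3 b1 b2 b3 c1 c2 c3 d1 d2 d3 : ℝ) :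
    (a1 * (b2 * c3 - b3 * c2) + a2 * (b3 * c1 - b1 * c3) + a3 * (b1 * c2 - b2 * c1)) *
    (d1 * (b2 * c3 - b3 * c2) + d2 * (b3 * c1 - b1 * c3) + d3 * (b1 * c2 - b2 * c1)) =
    (a1 * d1 + a2 * d2 + a3 * d3) *
      ((b1 * b1 + b2 * b2 + b3 * b3) * (c1 * c1 + c2 * c2 + c3 * c3)
        - (b1 * c1 + b2 * c2 + b3 * c3) ^ 2)
    - (a1 * b1 + a2 * b2 + a3 * b3) *
      ((b1 * d1 + b2 * d2 + b3 * d3) * (c1 * c1 + c2 * c2 + c3 * c3)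
        - (b1 * c1 + b2 * c2 + b3 * c3) * (c1 * d1 + c2 * d2 + c3 * d3))
    + (a1 * c1 + a2 * c2 + a3 * c3) *
      ((b1 * d1 + b2 * d2 + b3 * d3) * (b1 * c1 + b2 * c2 + b3 * c3)
        - (b1 * b1 + b2 * b2 + b3 * b3) * (c1 * d1 + c2 * d2 + c3 * d3)) := by
  ring

lemma four_vec (a1 a2 a3 b1 b2 b3 c1 c2 c3 d1 d2 d3 q1 q2 q3 : ℝ)
    (hab : a1 * b1 + a2 * b2 + a3 * b3 = 0) (hbc : b1 * c1 + b2 * c2 + b3 * c3 = 0)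
    (hcd : c1 * d1 + c2 * d2 + c3 * d3 = 0) (hac : a1 * c1 + a2 * c2 + a3 * c3 < 0)
    (hbd : b1 * d1 + b2 * d2 + b3 * d3 < 0)
    (ha : a1 * q1 + a2 * q2 + a3 * q3 ≤ 0) 
    (hc : c1 * q1 + c2 * q2 + c3 * q3 < 0) (hb' : b1 * q1 + b2 * q2 + b3 * q3 < 0)
    (hd : d1 * q1 + d2 * q2 + d3 * q3 ≤ 0)
    (hbb : 0 < b1 * b1 + b2 * b2 + b3 * b3) (hcc : 0 < c1 * c1 + c2 * c2 + c3 * c3) :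
    0 ≤ a1 * d1 + a2 * d2 + a3 * d3 := by
  have g1 := gram a1 a2 a3 b1 b2 b3 c1 c2 c3 d1 d2 d3
  have g2 := gram a1 a2 a3 b1 b2 b3 c1 c2 c3 q1 q2 q3
  have g3 := gram d1 d2 d3 b1 b2 b3 c1 c2 c3 q1 q2 q3
  have hdb : d1 * b1 + d2 * b2 + d3 * b3 < 0 := by linarith
  have hdc : d1 * c1 + d2 * c2 + d3 * c3 = 0 := by linarith
  rw [hab, hbc, hcd] at g1
  rw [hab, hbc] at g2
  rw [hdc, hbc] at g3
  set wa := a1 * (b2 * c3 - b3 * c2) + a2 * (b3 * c1 - b1 * c3) + a3 * (b1 * c2 - b2 * c1)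
  set wd := d1 * (b2 * c3 - b3 * c2) + d2 * (b3 * c1 - b1 * c3) + d3 * (b1 * c2 - b2 * c1)
  set wq := q1 * (b2 * c3 - b3 * c2) + q2 * (b3 * c1 - b1 * c3) + q3 * (b1 * c2 - b2 * c1)
  set B := b1 * b1 + b2 * b2 + b3 * b3
  set C := c1 * c1 + c2 * c2 + c3 * c3
  set aq := a1 * q1 + a2 * q2 + a3 * q3
  set bq := b1 * q1 + b2 * q2 + b3 * q3
  set cq := c1 * q1 + c2 * q2 + c3 * q3
  set dq := d1 * q1 + d2 * q2 + d3 * q3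
  set ac := a1 * c1 + a2 * c2 + a3 * c3
  set db := d1 * b1 + d2 * b2 + d3 * b3
  have n1 : wa * wq < 0 := by
    rw [g2]
    have := mul_pos (mul_pos_of_neg_of_neg hac hc) hbb
    have := mul_nonneg (mul_nonneg (neg_nonneg.2 ha) hbb.le) hcc.le
    linarith
  have n2 : wd * wq < 0 := by
    rw [g3]
    have := mul_pos (mul_pos_of_neg_of_neg hdb hb') hcc
    have := mul_nonneg (mul_nonneg (neg_nonneg.2 hd) hbb.le) hcc.le
    linarith
  have n3 : 0 < (wa * wd) * (wq * wq) := by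
    have := mul_pos_of_neg_of_neg n1 n2
    linarith
  have n4 : 0 < wa * wd := pos_of_mul_pos_left n3 (mul_self_nonneg _)
  rw [g1] at n4
  by_contra hneg
  push Not at hneg
  have := mul_pos (neg_pos.2 hneg) (mul_pos hbb hcc)
  linarith

lemma right_tri {t : ℝ} (ht : 0 < t) {a b c d q : T3} (Qa : OnQ t a) (Qb : OnQ t b) (Qc : OnQ t c)
    (Qd : OnQ t d) (Qq : OnQ t q) (hab : G t a b q = 0) (hbc : G t b c q = 0)
    (hcd : G t c d q = 0) (hac : G t a c q < 0) (hbd : G t b d q < 0) : 0 ≤ G t a d q := by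
  set e := √t with he
  have e0 : 0 < e := Real.sqrt_pos.2 ht
  have e2 : t = e * e := (Real.mul_self_sqrt ht.le).symm
  have hg : ∀ u v : T3, G t u v q = (u.x - q.x) * (v.x - q.x) + (u.y - q.y) * (v.y - q.y) +
      (e * (u.h - q.h)) * (e * (v.h - q.h)) := by
    intro u v; rw [e2]; simp only [G]; ring
  have hn : ∀ u : T3, OnQ t u → (u.x - q.x) * q.x + (u.y - q.y) * q.y
      + (e * (u.h - q.h)) * ((t * q.h - 1) / e) = - (G t u u q) / 2 := by
    intro u hu
    simp only [OnQ] at hu Qq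
    have : (e * (u.h - q.h)) * ((t * q.h - 1) / e) = (u.h - q.h) * (t * q.h - 1) := by
      field_simp
    rw [this]; simp only [G]
    linear_combination (1/2) * hu - (1/2) * Qq
  have hnn : ∀ u : T3, 0 ≤ G t u u q := by
    intro u; simp only [G]
    have := mul_nonneg ht.le (mul_self_nonneg (q.h - u.h))
    nlinarith [mul_self_nonneg (q.x - u.x), mul_self_nonneg (q.y - u.y)]
  have hpos : ∀ u v : T3, G t u v q < 0 → 0 < G t u u q ∧ 0 < G t v v q := by
    intro u v h
    have key : 0 ≤ G t u u q + 2 * G t u v q + G t v v q := by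
      have := hnn ⟨u.x + v.x - q.x, u.y + v.y - q.y, u.h + v.h - q.h⟩
      simp only [G] at this ⊢
      linarith
    have key2 : G t u v q ^ 2 ≤ G t u u q * G t v v q := by
      rw [hg, hg, hg]
      generalize u.x - q.x = x1
      generalize u.y - q.y = x2
      generalize e * (u.h - q.h) = x3
      generalize v.x - q.x = y1
      generalize v.y - q.y = y2
      generalize e * (v.h - q.h) = y3
      nlinarith [sq_nonneg (x1 * y2 - x2 * y1), sq_nonneg (x1 * y3 - x3 * y1),
        sq_nonneg (x2 * y3 - x3 * y2)]
    have h2 : 0 < G t u u q * G t v v q := lt_of_lt_of_le (sq_pos_of_neg h) key2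
    exact ⟨pos_of_mul_pos_left h2 (hnn _), pos_of_mul_pos_right h2 (hnn _)⟩
  have hb := (hpos b d hbd).1
  have hc := (hpos a c hac).2
  have na := hn a Qa
  have nb := hn b Qb
  have nc := hn c Qc
  have nd := hn d Qd
  have pa := hnn a
  have pd := hnn d
  rw [hg]
  apply four_vec _ _ _ (b.x - q.x) (b.y - q.y) (e * (b.h - q.h)) (c.x - q.x) (c.y - q.y)
    (e * (c.h - q.h)) _ _ _ q.x q.y ((t * q.h - 1) / e)
  · rw [← hg]; exact hab
  · rw [← hg]; exact hbc
  · rw [← hg]; exact hcd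
  · rw [← hg]; exact hac
  · rw [← hg]; exact hbd
  · linarith
  · linarith
  · linarith
  · linarith
  · rw [← hg]; exact hb
  · rw [← hg]; exact hc
/-! ### The zone -/

structure St where
  p : T3
  q : T3
  r : T3

def q00 (t : ℝ) : T3 := sol t 0 (3 / 2) ⟨0, 1, 0⟩ ⟨0, 1, 0⟩
def r00 (t : ℝ) : T3 := sol t 0 (5 / 2) ⟨0, 0, 0⟩ ⟨0, 1, 0⟩

def st0 (t : ℝ) : St := ⟨sol t 0 (1 / 2) (q00 t) (dif (r00 t) (q00 t)), q00 t, r00 t⟩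

def nxR (t : ℝ) (s : St) : T3 :=
  sol t 4 (7 / 2 - (dif s.r s.q).x - 4 * t * (dif s.r s.q).h) s.q (dif s.r s.q)

def nxP (t : ℝ) (s : St) : T3 := sol t 0 (1 / 2) s.q (dif (nxR t s) s.q)

def nxt (t : ℝ) (s : St) : St := ⟨nxP t s, para (nxP t s) (nxR t s) s.q, nxR t s⟩

def st (t : ℝ) : ℕ → St
  | 0 => st0 t
  | k + 1 => nxt t (st t k)

/-- flat position -/
def fl (x y : ℝ) : T3 := ⟨x, y, (x ^ 2 + y ^ 2) / 2⟩

lemma T3.ext' {a b : T3} (h1 : a.x = b.x) (h2 : a.y = b.y) (h3 : a.h = b.h) : a = b := by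
  cases a; cases b; simp_all

lemma Lim.of {P : ℝ → T3} {a b : T3} (h : Lim P a) (hx : a.x = b.x) (hy : a.y = b.y)
    (hh : a.h = b.h) : Lim P b := by
  rw [← T3.ext' hx hy hh]; exact h

structure Good (P Q R : ℝ → T3) (k : ℕ) : Prop where
  lp : Lim P (fl (1 / 2) (2 * k))
  lq : Lim Q (fl (3 / 2) (2 * k + 1))
  lr : Lim R (fl (5 / 2) (2 * k))
  ev : ∀ᶠ t in 𝓝[>] 0, OnQ t (P t) ∧ OnQ t (Q t) ∧ OnQ t (R t) ∧ (P t).x = 1 / 2 ∧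
    G t (P t) (R t) (Q t) = 0

lemma G_comm (t : ℝ) (i j l : T3) : G t i j l = G t j i l := by simp only [G]; ring

lemma good_zero : Good (fun t => (st t 0).p) (fun t => (st t 0).q) (fun t => (st t 0).r) 0 := by
  obtain ⟨lq, eq⟩ := sol_lim 0 (d := fun _ => 3 / 2) (d0 := 3 / 2) tendsto_const_nhds
    (Lim.const ⟨0, 1, 0⟩) (Lim.const ⟨0, 1, 0⟩) (by norm_num)
  obtain ⟨lr, er⟩ := sol_lim 0 (d := fun _ => 5 / 2) (d0 := 5 / 2) tendsto_const_nhds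
    (Lim.const ⟨0, 0, 0⟩) (Lim.const ⟨0, 1, 0⟩) (by norm_num)
  rw [sol_zero] at lq lr
  have lq' : Lim q00 (fl (3 / 2) 1) := by
    apply Lim.of (P := q00) lq <;> norm_num [fl]
  have lr' : Lim r00 (fl (5 / 2) 0) := by
    apply Lim.of (P := r00) lr <;> norm_num [fl]
  obtain ⟨lp, ep⟩ := sol_lim 0 (d := fun _ => 1 / 2) (d0 := 1 / 2) tendsto_const_nhds
    lq' (lr'.dif lq') (by norm_num [dif, fl])
  rw [sol_zero] at lp
  refine ⟨?_, ?_, ?_, ?_⟩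
  · apply Lim.of (P := fun t => (st t 0).p) lp <;> norm_num [fl, dif]
  · apply Lim.of (P := fun t => (st t 0).q) lq' <;> norm_num [fl]
  · apply Lim.of (P := fun t => (st t 0).r) lr' <;> norm_num [fl]
  · filter_upwards [eq, er, ep] with t h1 h2 h3
    obtain ⟨h3a, h3b, h3c⟩ := h3
    change (st t 0).p.x + 0 * t * (st t 0).p.h = 1 / 2 at h3b
    change ((st t 0).r.x - (st t 0).q.x) * ((st t 0).p.x - (st t 0).q.x) +
      ((st t 0).r.y - (st t 0).q.y) * ((st t 0).p.y - (st t 0).q.y) +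
      t * (((st t 0).r.h - (st t 0).q.h) * ((st t 0).p.h - (st t 0).q.h)) = 0 at h3c
    refine ⟨h3a, h1.1, h2.1, by linarith, ?_⟩
    simp only [G]
    linarith

lemma good_step (k : ℕ)
    (hg : Good (fun t => (st t k).p) (fun t => (st t k).q) (fun t => (st t k).r) k) :
    Good (fun t => (st t (k + 1)).p) (fun t => (st t (k + 1)).q) (fun t => (st t (k + 1)).r) (k + 1)
    ∧ ∀ᶠ t in 𝓝[>] 0, G t (st t k).r (st t (k + 1)).r (st t k).q = 0 ∧
        G t (st t (k + 1)).r (st t (k + 1)).p (st t k).q = 0 ∧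
        (para (st t k).r (st t (k + 1)).r (st t k).q).x +
          4 * t * (para (st t k).r (st t (k + 1)).r (st t k).q).h = 7 / 2 ∧
        OnQ t (para (st t k).r (st t (k + 1)).r (st t k).q) := by
  obtain ⟨lp, lq, lr, ev⟩ := hg
  have lf := lr.dif lq
  have hd : Tendsto (fun t => 7 / 2 - (dif (st t k).r (st t k).q).x
      - 4 * t * (dif (st t k).r (st t k).q).h) (𝓝[>] 0) (𝓝 (5 / 2)) := by
    have := (lf.1.const_sub (7 / 2)).sub ((tend_t.const_mul 4).mul lf.2.2)
    convert this using 2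
    norm_num [dif, fl]
  obtain ⟨lR, eR⟩ := sol_lim 4 hd lq lf (by norm_num [dif, fl])
  rw [sol_zero] at lR
  have lR' : Lim (fun t => (st t (k + 1)).r) (fl (5 / 2) (2 * (k + 1))) := by
    refine Lim.of (P := fun t => (st t (k + 1)).r) lR rfl ?_ ?_
    · norm_num [fl, dif]; ring
    · norm_num [fl, dif]; ring
  obtain ⟨lP, eP⟩ := sol_lim 0 (d := fun _ => 1 / 2) (d0 := 1 / 2) tendsto_const_nhds
    lq (lR'.dif lq) (by norm_num [dif, fl]; ring_nf; norm_num)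
  rw [sol_zero] at lP
  have lP' : Lim (fun t => (st t (k + 1)).p) (fl (1 / 2) (2 * (k + 1))) := by
    have e1 : (2 * ((k : ℝ) + 1) - (2 * k + 1)) = 1 := by ring
    refine Lim.of (P := fun t => (st t (k + 1)).p) lP rfl ?_ ?_
    · norm_num [fl, dif, e1]; ring
    · norm_num [fl, dif, e1]; ring
  have lQ' : Lim (fun t => (st t (k + 1)).q) (fl (3 / 2) (2 * (k + 1) + 1)) := by
    apply Lim.of (P := fun t => (st t (k + 1)).q) (lP'.para lR' lq) <;> simp only [fl, para] <;> ring
  have all := (ev.and (eR.and eP))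
  have fin : ∀ᶠ t in 𝓝[>] 0, (OnQ t (st t (k + 1)).p ∧ OnQ t (st t (k + 1)).q ∧
      OnQ t (st t (k + 1)).r ∧ (st t (k + 1)).p.x = 1 / 2 ∧
      G t (st t (k + 1)).p (st t (k + 1)).r (st t (k + 1)).q = 0) ∧
      (G t (st t k).r (st t (k + 1)).r (st t k).q = 0 ∧
        G t (st t (k + 1)).r (st t (k + 1)).p (st t k).q = 0 ∧
        (para (st t k).r (st t (k + 1)).r (st t k).q).x +
          4 * t * (para (st t k).r (st t (k + 1)).r (st t k).q).h = 7 / 2 ∧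
        OnQ t (para (st t k).r (st t (k + 1)).r (st t k).q)) := by
    filter_upwards [all] with t h
    obtain ⟨⟨h1, h2, h3, h4, h5⟩, ⟨h6, h7, h8⟩, h9, h10, h11⟩ := h
    change OnQ t (st t (k + 1)).r at h6
    change (st t (k + 1)).r.x + 4 * t * (st t (k + 1)).r.h = _ at h7
    change (dif (st t k).r (st t k).q).x * ((st t (k + 1)).r.x - (st t k).q.x) +
      (dif (st t k).r (st t k).q).y * ((st t (k + 1)).r.y - (st t k).q.y) +
      t * ((dif (st t k).r (st t k).q).h * ((st t (k + 1)).r.h - (st t k).q.h)) = 0 at h8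
    change OnQ t (st t (k + 1)).p at h9
    change (st t (k + 1)).p.x + 0 * t * (st t (k + 1)).p.h = 1 / 2 at h10
    change (dif (st t (k + 1)).r (st t k).q).x * ((st t (k + 1)).p.x - (st t k).q.x) +
      (dif (st t (k + 1)).r (st t k).q).y * ((st t (k + 1)).p.y - (st t k).q.y) +
      t * ((dif (st t (k + 1)).r (st t k).q).h * ((st t (k + 1)).p.h - (st t k).q.h)) = 0 at h11
    have hq : (st t (k + 1)).q = para (st t (k + 1)).p (st t (k + 1)).r (st t k).q := rfl
    rw [hq]
    generalize (st t (k + 1)).p = p' at *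
    generalize (st t (k + 1)).r = r' at *
    generalize (st t k).p = p at *
    generalize (st t k).r = r at *
    generalize (st t k).q = q at *
    simp only [OnQ, G, para, dif] at *
    refine ⟨⟨h9, ?_, h6, by linarith, by linarith⟩, by linarith, by linarith, by linarith, ?_⟩
    · linear_combination h9 + h6 - h2 + 2 * h11
    · linear_combination h3 + h6 - h2 + 2 * h8
  refine ⟨⟨?_, ?_, ?_, fin.mono fun t h => h.1⟩, fin.mono fun t h => h.2⟩
  · push_cast; exact lP'
  · push_cast; exact lQ'
  · push_cast; exact lR'

lemma good (k : ℕ) :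
    Good (fun t => (st t k).p) (fun t => (st t k).q) (fun t => (st t k).r) k := by
  induction k with
  | zero => exact good_zero
  | succ k ih => exact (good_step k ih).1

/-- The zone points. -/
def Z (t : ℝ) (τ : Fin 4) (k : ℕ) : T3 :=
  match τ with
  | 0 => (st t k).p
  | 1 => (st t k).q
  | 2 => (st t k).r
  | 3 => para (st t k).r (st t (k + 1)).r (st t k).q

def yI (τ : Fin 4) (k : ℕ) : ℤ := 2 * k + (τ.val % 2 : ℕ)

lemma Z_lim (τ : Fin 4) (k : ℕ) :
    Lim (fun t => Z t τ k) (fl ((τ.val : ℝ) + 1 / 2) (yI τ k)) := by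
  have h := good k
  have h' := good (k + 1)
  fin_cases τ
  · apply Lim.of (P := fun t => (st t k).p) h.lp <;> norm_num [yI, fl]
  · apply Lim.of (P := fun t => (st t k).q) h.lq <;> norm_num [yI, fl]
  · apply Lim.of (P := fun t => (st t k).r) h.lr <;> norm_num [yI, fl]
  · have := h.lr.para h'.lr h.lq
    apply Lim.of (P := fun t => para (st t k).r (st t (k + 1)).r (st t k).q) this <;>
      norm_num [yI, fl, para] <;> ring

structure ZFacts (t : ℝ) (k : ℕ) : Prop where
  on : ∀ τ, OnQ t (Z t τ k)
  px : (Z t 0 k).x = 1 / 2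
  sx : (Z t 3 k).x + 4 * t * (Z t 3 k).h = 7 / 2
  h1 : G t (Z t 0 k) (Z t 2 k) (Z t 1 k) = 0
  h2 : G t (Z t 2 k) (Z t 2 (k + 1)) (Z t 1 k) = 0
  h3 : G t (Z t 2 (k + 1)) (Z t 0 (k + 1)) (Z t 1 k) = 0
  hq : Z t 1 (k + 1) = para (Z t 0 (k + 1)) (Z t 2 (k + 1)) (Z t 1 k)
  hs : Z t 3 k = para (Z t 2 k) (Z t 2 (k + 1)) (Z t 1 k)
  n1 : G t (Z t 0 k) (Z t 2 (k + 1)) (Z t 1 k) < 0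
  n2 : G t (Z t 2 k) (Z t 0 (k + 1)) (Z t 1 k) < 0
  n3 : G t (Z t 3 k) (Z t 1 (k + 1)) (Z t 2 (k + 1)) < 0
  n4 : G t (Z t 1 k) (Z t 3 (k + 1)) (Z t 2 (k + 1)) < 0

lemma ev_neg {P Q R : ℝ → T3} {a b c : T3} (hP : Lim P a) (hQ : Lim Q b) (hR : Lim R c)
    (h : G 0 a b c < 0) : ∀ᶠ t in 𝓝[>] 0, G t (P t) (Q t) (R t) < 0 :=
  (hP.G hQ hR).eventually_lt_const h

lemma zfacts (k : ℕ) : ∀ᶠ t in 𝓝[>] 0, ZFacts t k := by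
  have e1 := (good k).ev
  have e2 := (good_step k (good k)).2
  have m1 := ev_neg (Z_lim 0 k) (Z_lim 2 (k + 1)) (Z_lim 1 k)
    (by norm_num [G, fl, yI]; ring_nf; norm_num)
  have m2 := ev_neg (Z_lim 2 k) (Z_lim 0 (k + 1)) (Z_lim 1 k)
    (by norm_num [G, fl, yI]; ring_nf; norm_num)
  have m3 := ev_neg (Z_lim 3 k) (Z_lim 1 (k + 1)) (Z_lim 2 (k + 1))
    (by norm_num [G, fl, yI]; ring_nf; norm_num)
  have m4 := ev_neg (Z_lim 1 k) (Z_lim 3 (k + 1)) (Z_lim 2 (k + 1))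
    (by norm_num [G, fl, yI]; ring_nf; norm_num)
  filter_upwards [e1, e2, m1, m2, m3, m4] with t h1 h2 h3 h4 h5 h6
  refine ⟨?_, h1.2.2.2.1, h2.2.2.1, h1.2.2.2.2, h2.1, h2.2.1, rfl, rfl, h3, h4, h5, h6⟩
  intro τ
  fin_cases τ
  · exact h1.1
  · exact h1.2.1
  · exact h1.2.2.1
  · exact h2.2.2.2

/-- right triangles -/
lemma tri_p {t : ℝ} (ht : 0 < t) {k : ℕ} (h : ZFacts t k) (h' : ZFacts t (k + 1)) :
    0 ≤ G t (Z t 0 k) (Z t 0 (k + 1)) (Z t 1 k) :=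
  right_tri ht (h.on 0) (h.on 2) (h'.on 2) (h'.on 0) (h.on 1) h.h1 h.h2 h.h3 h.n1 h.n2

lemma tri_s {t : ℝ} (ht : 0 < t) {k : ℕ} (h : ZFacts t k) (h' : ZFacts t (k + 1)) :
    0 ≤ G t (Z t 3 k) (Z t 3 (k + 1)) (Z t 2 (k + 1)) := by
  refine right_tri ht (h.on 3) (h.on 1) (h'.on 1) (h'.on 3) (h'.on 2) ?_ ?_ ?_ h.n3 h.n4
  · have := h.h2
    rw [h.hs]; simp only [G, para] at *; linarith
  · have := h.h3
    rw [h.hq]; simp only [G, para] at *; linarith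
  · have := h'.h2
    rw [h'.hs]; simp only [G, para] at *; linarith
/-! ### Reflections and all zones -/

def rA (a : T3) : T3 := ⟨-a.x, a.y, a.h⟩

def rB (t : ℝ) (a : T3) : T3 :=
  ⟨a.x - 2 * ((a.x - 4 + 4 * t * a.h) / (1 + 16 * t)), a.y,
    a.h - 8 * ((a.x - 4 + 4 * t * a.h) / (1 + 16 * t))⟩

def rS (t : ℝ) (m : ℕ) (a : T3) : T3 := if m % 2 = 0 then rB t a else rA a

def TT (t : ℝ) : ℕ → T3 → T3
  | 0, a => a
  | m + 1, a => TT t m (rS t m a)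

lemma rB_G {t : ℝ} (ht : 0 < t) (a b c : T3) :
    G t (rB t a) (rB t b) (rB t c) = G t a b c := by
  have h : 1 + 16 * t ≠ 0 := by positivity
  simp only [G, rB]
  field_simp
  ring

lemma rB_on {t : ℝ} (ht : 0 < t) {a : T3} (ha : OnQ t a) : OnQ t (rB t a) := by
  have h : 1 + 16 * t ≠ 0 := by positivity
  simp only [OnQ, rB] at *
  have hw : (a.x - 4 + 4 * t * a.h) / (1 + 16 * t) * (1 + 16 * t) = a.x - 4 + 4 * t * a.h := by
    field_simp
  generalize (a.x - 4 + 4 * t * a.h) / (1 + 16 * t) = w at *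
  linear_combination ha + 4 * w * hw

lemma rB_inv {t : ℝ} (ht : 0 < t) (a : T3) : rB t (rB t a) = a := by
  have h : 1 + 16 * t ≠ 0 := by positivity
  apply T3.ext'
  · simp only [rB]; field_simp; ring
  · rfl
  · simp only [rB]; field_simp; ring

lemma rS_G {t : ℝ} (ht : 0 < t) (m : ℕ) (a b c : T3) :
    G t (rS t m a) (rS t m b) (rS t m c) = G t a b c := by
  simp only [rS]; split_ifs
  · exact rB_G ht a b c
  · simp only [G, rA]; ring

lemma rS_on {t : ℝ} (ht : 0 < t) (m : ℕ) {a : T3} (ha : OnQ t a) : OnQ t (rS t m a) := by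
  simp only [rS]; split_ifs
  · exact rB_on ht ha
  · simp only [OnQ, rA] at *; linarith

lemma rS_inv {t : ℝ} (ht : 0 < t) (m : ℕ) (a : T3) : rS t m (rS t m a) = a := by
  simp only [rS]; split_ifs
  · exact rB_inv ht a
  · simp [rA]

lemma TT_G {t : ℝ} (ht : 0 < t) (m : ℕ) : ∀ a b c : T3,
    G t (TT t m a) (TT t m b) (TT t m c) = G t a b c := by
  induction m with
  | zero => intro a b c; rfl
  | succ m ih => intro a b c; simp only [TT]; rw [ih, rS_G ht]

lemma TT_on {t : ℝ} (ht : 0 < t) (m : ℕ) : ∀ {a : T3}, OnQ t a → OnQ t (TT t m a) := by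
  induction m with
  | zero => intro a h; exact h
  | succ m ih => intro a h; exact ih (rS_on ht m h)

lemma Lim.rS {P : ℝ → T3} {a : T3} (h : Lim P a) (m : ℕ) :
    Lim (fun t => rS t m (P t)) (rS 0 m a) := by
  simp only [_root_.rS]; split_ifs
  · have hw : Tendsto (fun t => ((P t).x - 4 + 4 * t * (P t).h) / (1 + 16 * t)) (𝓝[>] 0)
        (𝓝 ((a.x - 4 + 4 * 0 * a.h) / (1 + 16 * 0))) :=
      ((h.1.sub_const 4).add ((tend_t.const_mul 4).mul h.2.2)).div
        ((tend_t.const_mul 16).const_add 1) (by norm_num)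
    exact ⟨h.1.sub (hw.const_mul 2), h.2.1, h.2.2.sub (hw.const_mul 8)⟩
  · exact ⟨h.1.neg, h.2.1, h.2.2⟩

lemma Lim.TT (m : ℕ) : ∀ {P : ℝ → T3} {a : T3}, Lim P a →
    Lim (fun t => TT t m (P t)) (TT 0 m a) := by
  induction m with
  | zero => intro P a h; exact h
  | succ m ih => intro P a h; exact ih (h.rS m)

lemma TT_zero (m : ℕ) : ∀ a : T3, (TT 0 m a).y = a.y ∧
    (TT 0 m a).x = if m % 2 = 0 then 4 * (m : ℝ) + a.x else 4 * (m : ℝ) + 4 - a.x := by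
  induction m with
  | zero => intro a; simp [TT]
  | succ m ih =>
    intro a
    simp only [TT]
    rw [(ih _).1, (ih _).2]
    rcases Nat.mod_two_eq_zero_or_one m with h | h
    · have h' : (m + 1) % 2 = 1 := by omega
      simp [h, h', rS, rB]; ring
    · have h' : (m + 1) % 2 = 0 := by omega
      simp [h, h', rS, rA]; ring

abbrev Ix := ℕ × Fin 4 × ℕ

def Pos (t : ℝ) (i : Ix) : T3 := TT t i.1 (Z t i.2.1 i.2.2)

def col (m : ℕ) (τ : Fin 4) : ℤ :=
  if m % 2 = 0 then 4 * (m : ℤ) + (τ.val : ℤ) else 4 * (m : ℤ) + 3 - (τ.val : ℤ)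

def fl0 (i : Ix) : T3 := TT 0 i.1 (fl ((i.2.1.val : ℝ) + 1 / 2) (yI i.2.1 i.2.2))

lemma Pos_lim (i : Ix) : Lim (fun t => Pos t i) (fl0 i) := (Z_lim i.2.1 i.2.2).TT i.1

lemma fl0_x (i : Ix) : (fl0 i).x = (col i.1 i.2.1 : ℝ) + 1 / 2 := by
  rw [fl0, (TT_zero _ _).2]
  simp only [col, fl]
  split_ifs <;> push_cast <;> ring

lemma fl0_y (i : Ix) : (fl0 i).y = (yI i.2.1 i.2.2 : ℝ) := by
  rw [fl0, (TT_zero _ _).1]; rfl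

def FF (i j l : Ix) : ℤ :=
  (col l.1 l.2.1 - col i.1 i.2.1) * (col l.1 l.2.1 - col j.1 j.2.1) +
  (yI l.2.1 l.2.2 - yI i.2.1 i.2.2) * (yI l.2.1 l.2.2 - yI j.2.1 j.2.2)

def Ok (i j l : Ix) : Prop := ∀ᶠ t in 𝓝[>] (0 : ℝ), 0 ≤ G t (Pos t i) (Pos t j) (Pos t l)

lemma Ok.of_pos {i j l : Ix} (h : 0 < FF i j l) : Ok i j l := by
  have h1 := (Pos_lim i).G (Pos_lim j) (Pos_lim l)
  have h2 : G 0 (fl0 i) (fl0 j) (fl0 l) = (FF i j l : ℝ) := by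
    simp only [G, fl0_x, fl0_y, FF]; push_cast; ring
  rw [h2] at h1
  have h3 : (0 : ℝ) < (FF i j l : ℝ) := by exact_mod_cast h
  exact (h1.eventually_const_lt h3).mono fun t ht => ht.le

lemma Ok.left (i j : Ix) : Ok i j i := Eventually.of_forall fun t => by simp [G]

lemma Ok.right (i j : Ix) : Ok i j j := Eventually.of_forall fun t => by simp [G]

lemma Ok.symm {i j l : Ix} (h : Ok i j l) : Ok j i l := h.mono fun t ht => by rwa [G_comm]

lemma ev_pos_t : ∀ᶠ t in 𝓝[>] (0 : ℝ), 0 < t := eventually_mem_nhdsWithin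

/-- transfer of a fact in the basic zone -/
lemma Ok.zone (m : ℕ) {a b c : Fin 4 × ℕ}
    (h : ∀ᶠ t in 𝓝[>] (0 : ℝ), 0 ≤ G t (Z t a.1 a.2) (Z t b.1 b.2) (Z t c.1 c.2)) :
    Ok (m, a) (m, b) (m, c) := by
  filter_upwards [h, ev_pos_t] with t h1 h2
  simp only [Pos]; rwa [TT_G h2]

def Gab (i j : Ix) : Prop := ∀ l, Ok i j l

lemma Gab.symm {i j : Ix} (h : Gab i j) : Gab j i := fun l => (h l).symm

lemma key02 (u v : ℤ) : 0 < u * u + v * (v - 2) ∨ (u = 0 ∧ 0 ≤ v ∧ v ≤ 2) ∨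
    ((u = 1 ∨ u = -1) ∧ v = 1) := by
  by_cases h1 : u = 0
  · subst h1
    by_cases h : 0 ≤ v ∧ v ≤ 2
    · right; left; exact ⟨rfl, h⟩
    · left
      rcases not_and_or.1 h with h | h <;> nlinarith
  · by_cases hv : v = 1
    · subst hv
      by_cases hu : u = 1 ∨ u = -1
      · right; right; exact ⟨hu, rfl⟩
      · left
        have : 2 ≤ u ∨ u ≤ -2 := by omega
        rcases this with h | h <;> nlinarith
    · left
      have h2 : 1 ≤ u ∨ u ≤ -1 := by omega
      have h3 : 2 ≤ v ∨ v ≤ 0 := by omega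
      rcases h2 with h | h <;> rcases h3 with h' | h' <;> nlinarith

lemma key20 (u v : ℤ) : 0 < u * (u - 2) + v * v ∨ (v = 0 ∧ 0 ≤ u ∧ u ≤ 2) ∨
    ((v = 1 ∨ v = -1) ∧ u = 1) := by
  rw [add_comm]; exact key02 v u

lemma mul_pred (u : ℤ) : 0 ≤ u * (u - 1) ∧ (2 ≤ u * (u - 1) ∨ u = 0 ∨ u = 1) := by
  have : u ≤ -1 ∨ u = 0 ∨ u = 1 ∨ 2 ≤ u := by omega
  rcases this with h | h | h | h
  · constructor
    · nlinarith
    · left; nlinarith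
  · subst h; simp
  · subst h; simp
  · constructor
    · nlinarith
    · left; nlinarith

lemma key11 (u v : ℤ) : 0 < u * (u - 1) + v * (v - 1) ∨ ((u = 0 ∨ u = 1) ∧ (v = 0 ∨ v = 1)) := by
  have h1 := mul_pred u
  have h2 := mul_pred v
  rcases h1.2 with h | h
  · left; linarith [h2.1]
  · rcases h2.2 with h' | h'
    · left; linarith [h1.1]
    · right; exact ⟨h, h'⟩

lemma key10 (u v : ℤ) : 0 < u * (u - 1) + v * v ∨ ((u = 0 ∨ u = 1) ∧ v = 0) := by
  have h1 := mul_pred u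
  by_cases hv : v = 0
  · subst hv
    rcases h1.2 with h | h
    · left; linarith
    · right; exact ⟨h, rfl⟩
  · left
    have := mul_self_pos.2 hv
    linarith

lemma key12 (u v : ℤ) : 0 < u * (u - 1) + v * (v - 2) ∨
    ((u = 0 ∨ u = 1) ∧ 0 ≤ v ∧ v ≤ 2) := by
  have h1 := mul_pred u
  by_cases hv : 0 ≤ v ∧ v ≤ 2
  · rcases h1.2 with h | h
    · left; nlinarith [sq_nonneg (v - 1)]
    · right; exact ⟨h, hv⟩
  · left
    rcases not_and_or.1 hv with h | h <;> nlinarith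
lemma F02 {i j l : Ix} (hc : col j.1 j.2.1 = col i.1 i.2.1)
    (hy : yI j.2.1 j.2.2 = yI i.2.1 i.2.2 + 2) : 0 < FF i j l ∨
    (col l.1 l.2.1 = col i.1 i.2.1 ∧ yI i.2.1 i.2.2 ≤ yI l.2.1 l.2.2 ∧
      yI l.2.1 l.2.2 ≤ yI i.2.1 i.2.2 + 2) ∨
    ((col l.1 l.2.1 = col i.1 i.2.1 + 1 ∨ col l.1 l.2.1 = col i.1 i.2.1 - 1) ∧
      yI l.2.1 l.2.2 = yI i.2.1 i.2.2 + 1) := by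
  have e := key02 (col l.1 l.2.1 - col i.1 i.2.1) (yI l.2.1 l.2.2 - yI i.2.1 i.2.2)
  simp only [FF, hc, hy]
  rcases e with e | e
  · left; linarith
  · right; omega

lemma F11 {i j l : Ix} (hc : col j.1 j.2.1 = col i.1 i.2.1 + 1 ∨ col j.1 j.2.1 = col i.1 i.2.1 - 1)
    (hy : yI j.2.1 j.2.2 = yI i.2.1 i.2.2 + 1) : 0 < FF i j l ∨
    ((col l.1 l.2.1 = col i.1 i.2.1 ∨ col l.1 l.2.1 = col j.1 j.2.1) ∧
      (yI l.2.1 l.2.2 = yI i.2.1 i.2.2 ∨ yI l.2.1 l.2.2 = yI j.2.1 j.2.2)) := by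
  have e := key11 (col l.1 l.2.1 - col i.1 i.2.1) (yI l.2.1 l.2.2 - yI i.2.1 i.2.2)
  have e' := key11 (-(col l.1 l.2.1 - col i.1 i.2.1)) (yI l.2.1 l.2.2 - yI i.2.1 i.2.2)
  rcases hc with hc | hc <;> simp only [FF, hc, hy]
  · rcases e with e | e
    · left; linarith
    · right; omega
  · rcases e' with e | e
    · left; linarith
    · right; omega

lemma F20 {i j l : Ix} (hc : col j.1 j.2.1 = col i.1 i.2.1 + 2 ∨ col j.1 j.2.1 = col i.1 i.2.1 - 2)
    (hy : yI j.2.1 j.2.2 = yI i.2.1 i.2.2) : 0 < FF i j l ∨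
    (yI l.2.1 l.2.2 = yI i.2.1 i.2.2 ∧ (col l.1 l.2.1 = col i.1 i.2.1 ∨
      col l.1 l.2.1 = col j.1 j.2.1 ∨ 2 * col l.1 l.2.1 = col i.1 i.2.1 + col j.1 j.2.1)) ∨
    ((yI l.2.1 l.2.2 = yI i.2.1 i.2.2 + 1 ∨ yI l.2.1 l.2.2 = yI i.2.1 i.2.2 - 1) ∧
      2 * col l.1 l.2.1 = col i.1 i.2.1 + col j.1 j.2.1) := by
  have e := key20 (col l.1 l.2.1 - col i.1 i.2.1) (yI l.2.1 l.2.2 - yI i.2.1 i.2.2)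
  have e' := key20 (-(col l.1 l.2.1 - col i.1 i.2.1)) (yI l.2.1 l.2.2 - yI i.2.1 i.2.2)
  rcases hc with hc | hc <;> simp only [FF, hc, hy]
  · rcases e with e | e
    · left; linarith
    · right; omega
  · rcases e' with e | e
    · left; linarith
    · right; omega

lemma F10 {i j l : Ix} (hc : col j.1 j.2.1 = col i.1 i.2.1 + 1)
    (hy : yI j.2.1 j.2.2 = yI i.2.1 i.2.2) : 0 < FF i j l ∨
    ((col l.1 l.2.1 = col i.1 i.2.1 ∨ col l.1 l.2.1 = col j.1 j.2.1) ∧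
      yI l.2.1 l.2.2 = yI i.2.1 i.2.2) := by
  have e := key10 (col l.1 l.2.1 - col i.1 i.2.1) (yI l.2.1 l.2.2 - yI i.2.1 i.2.2)
  simp only [FF, hc, hy]
  rcases e with e | e
  · left; linarith
  · right; omega

lemma F12 {i j l : Ix} (hc : col j.1 j.2.1 = col i.1 i.2.1 + 1 ∨ col j.1 j.2.1 = col i.1 i.2.1 - 1)
    (hy : yI j.2.1 j.2.2 = yI i.2.1 i.2.2 + 2) : 0 < FF i j l ∨
    ((col l.1 l.2.1 = col i.1 i.2.1 ∨ col l.1 l.2.1 = col j.1 j.2.1) ∧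
      yI i.2.1 i.2.2 ≤ yI l.2.1 l.2.2 ∧ yI l.2.1 l.2.2 ≤ yI i.2.1 i.2.2 + 2) := by
  have e := key12 (col l.1 l.2.1 - col i.1 i.2.1) (yI l.2.1 l.2.2 - yI i.2.1 i.2.2)
  have e' := key12 (-(col l.1 l.2.1 - col i.1 i.2.1)) (yI l.2.1 l.2.2 - yI i.2.1 i.2.2)
  rcases hc with hc | hc <;> simp only [FF, hc, hy]
  · rcases e with e | e
    · left; linarith
    · right; omega
  · rcases e' with e | e
    · left; linarith
    · right; omega

def wl (m : ℕ) : Fin 4 := if m % 2 = 0 then 3 else 0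

lemma strip_G {t : ℝ} (m k k' : ℕ) (h : ZFacts t k) (h' : ZFacts t k') :
    G t (Z t (wl m) k) (rS t m (Z t (wl m) k')) (Z t (wl m) k') = 0 := by
  simp only [wl, rS]
  split_ifs
  · have e1 := h.sx
    have e2 := h'.sx
    simp only [G, rB]
    linear_combination (2 * (((Z t 3 k').x - 4 + 4 * t * (Z t 3 k').h) / (1 + 16 * t))) * (e2 - e1)
  · have e1 := h.px
    have e2 := h'.px
    simp only [G, rA, e1, e2]; ring

lemma strip1 (m k k' : ℕ) : Ok (m, wl m, k) (m + 1, wl m, k') (m, wl m, k') := by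
  filter_upwards [zfacts k, zfacts k', ev_pos_t] with t h h' ht
  simp only [Pos, TT]
  rw [TT_G ht, strip_G m k k' h h']

lemma strip2 (m k k' : ℕ) : Ok (m, wl m, k) (m + 1, wl m, k') (m + 1, wl m, k) := by
  filter_upwards [zfacts k, zfacts k', ev_pos_t] with t h h' ht
  simp only [Pos, TT]
  rw [TT_G ht, ← rS_G ht m, rS_inv ht, rS_inv ht, G_comm, strip_G m k' k h' h]

lemma gab_pp (m k : ℕ) : Gab (m, 0, k) (m, 0, k + 1) := by
  rintro ⟨m', τ, k'⟩
  have key : 0 < FF (m, 0, k) (m, 0, k + 1) (m', τ, k') ∨ (m', τ, k') = (m, (0 : Fin 4), k) ∨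
      (m', τ, k') = (m, (0 : Fin 4), k + 1) ∨
      (m', τ, k') = (m, (1 : Fin 4), k) := by
    refine (F02 (i := (m, 0, k)) (j := (m, 0, k + 1)) (l := (m', τ, k')) ?_ ?_).imp id fun e => ?_
    · simp [col] <;> omega
    · simp [yI] <;> ring
    · simp only [Prod.mk.injEq]
      fin_cases τ <;> simp [col, yI] at e ⊢ <;> split_ifs at e <;> omega
  rcases key with h | h | h | h
  · exact Ok.of_pos h
  · rw [h]; exact Ok.left _ _
  · rw [h]; exact Ok.right _ _
  · rw [h]; apply Ok.zone
    filter_upwards [zfacts k, zfacts (k + 1), ev_pos_t] with t h1 h2 h3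
    exact tri_p h3 h1 h2

lemma gab_qq (m k : ℕ) : Gab (m, 1, k) (m, 1, k + 1) := by
  rintro ⟨m', τ, k'⟩
  have key : 0 < FF (m, 1, k) (m, 1, k + 1) (m', τ, k') ∨ (m', τ, k') = (m, (1 : Fin 4), k) ∨
      (m', τ, k') = (m, (1 : Fin 4), k + 1) ∨
      (m', τ, k') = (m, (0 : Fin 4), k + 1) ∨
      (m', τ, k') = (m, (2 : Fin 4), k + 1) := by
    refine (F02 (i := (m, 1, k)) (j := (m, 1, k + 1)) (l := (m', τ, k')) ?_ ?_).imp id fun e => ?_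
    · simp [col] <;> omega
    · simp [yI] <;> ring
    · simp only [Prod.mk.injEq]
      fin_cases τ <;> simp [col, yI] at e ⊢ <;> split_ifs at e <;> omega
  rcases key with h | h | h | h | h
  · exact Ok.of_pos h
  · rw [h]; exact Ok.left _ _
  · rw [h]; exact Ok.right _ _
  · rw [h]; apply Ok.zone
    filter_upwards [zfacts k, zfacts (k + 1)] with t h1 h2
    have := h1.h3
    simp only [G, para, h1.hq, h1.hs] at *; linarith
  · rw [h]; apply Ok.zone
    filter_upwards [zfacts k, zfacts (k + 1)] with t h1 h2
    have := h1.h3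
    simp only [G, para, h1.hq, h1.hs] at *; linarith

lemma gab_rr (m k : ℕ) : Gab (m, 2, k) (m, 2, k + 1) := by
  rintro ⟨m', τ, k'⟩
  have key : 0 < FF (m, 2, k) (m, 2, k + 1) (m', τ, k') ∨ (m', τ, k') = (m, (2 : Fin 4), k) ∨
      (m', τ, k') = (m, (2 : Fin 4), k + 1) ∨
      (m', τ, k') = (m, (1 : Fin 4), k) ∨
      (m', τ, k') = (m, (3 : Fin 4), k) := by
    refine (F02 (i := (m, 2, k)) (j := (m, 2, k + 1)) (l := (m', τ, k')) ?_ ?_).imp id fun e => ?_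
    · simp [col] <;> omega
    · simp [yI] <;> ring
    · simp only [Prod.mk.injEq]
      fin_cases τ <;> simp [col, yI] at e ⊢ <;> split_ifs at e <;> omega
  rcases key with h | h | h | h | h
  · exact Ok.of_pos h
  · rw [h]; exact Ok.left _ _
  · rw [h]; exact Ok.right _ _
  · rw [h]; apply Ok.zone
    filter_upwards [zfacts k, zfacts (k + 1)] with t h1 h2
    have := h1.h2
    simp only [G, para, h1.hq, h1.hs] at *; linarith
  · rw [h]; apply Ok.zone
    filter_upwards [zfacts k, zfacts (k + 1)] with t h1 h2
    have := h1.h2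
    simp only [G, para, h1.hq, h1.hs] at *; linarith

lemma gab_ss (m k : ℕ) : Gab (m, 3, k) (m, 3, k + 1) := by
  rintro ⟨m', τ, k'⟩
  have key : 0 < FF (m, 3, k) (m, 3, k + 1) (m', τ, k') ∨ (m', τ, k') = (m, (3 : Fin 4), k) ∨
      (m', τ, k') = (m, (3 : Fin 4), k + 1) ∨
      (m', τ, k') = (m, (2 : Fin 4), k + 1) := by
    refine (F02 (i := (m, 3, k)) (j := (m, 3, k + 1)) (l := (m', τ, k')) ?_ ?_).imp id fun e => ?_
    · simp [col] <;> omega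
    · simp [yI] <;> ring
    · simp only [Prod.mk.injEq]
      fin_cases τ <;> simp [col, yI] at e ⊢ <;> split_ifs at e <;> omega
  rcases key with h | h | h | h
  · exact Ok.of_pos h
  · rw [h]; exact Ok.left _ _
  · rw [h]; exact Ok.right _ _
  · rw [h]; apply Ok.zone
    filter_upwards [zfacts k, zfacts (k + 1), ev_pos_t] with t h1 h2 h3
    exact tri_s h3 h1 h2

lemma gab_pq (m k : ℕ) : Gab (m, 0, k) (m, 1, k) := by
  rintro ⟨m', τ, k'⟩
  have key : 0 < FF (m, 0, k) (m, 1, k) (m', τ, k') ∨ (m', τ, k') = (m, (0 : Fin 4), k) ∨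
      (m', τ, k') = (m, (1 : Fin 4), k) := by
    refine (F11 (i := (m, 0, k)) (j := (m, 1, k)) (l := (m', τ, k')) ?_ ?_).imp id fun e => ?_
    · simp [col] <;> omega
    · simp [yI] <;> ring
    · simp only [Prod.mk.injEq]
      fin_cases τ <;> simp [col, yI] at e ⊢ <;> split_ifs at e <;> omega
  rcases key with h | h | h
  · exact Ok.of_pos h
  · rw [h]; exact Ok.left _ _
  · rw [h]; exact Ok.right _ _

lemma gab_qp (m k : ℕ) : Gab (m, 1, k) (m, 0, k + 1) := by
  rintro ⟨m', τ, k'⟩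
  have key : 0 < FF (m, 1, k) (m, 0, k + 1) (m', τ, k') ∨ (m', τ, k') = (m, (1 : Fin 4), k) ∨
      (m', τ, k') = (m, (0 : Fin 4), k + 1) := by
    refine (F11 (i := (m, 1, k)) (j := (m, 0, k + 1)) (l := (m', τ, k')) ?_ ?_).imp id fun e => ?_
    · simp [col] <;> omega
    · simp [yI] <;> ring
    · simp only [Prod.mk.injEq]
      fin_cases τ <;> simp [col, yI] at e ⊢ <;> split_ifs at e <;> omega
  rcases key with h | h | h
  · exact Ok.of_pos h
  · rw [h]; exact Ok.left _ _
  · rw [h]; exact Ok.right _ _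

lemma gab_rq (m k : ℕ) : Gab (m, 2, k) (m, 1, k) := by
  rintro ⟨m', τ, k'⟩
  have key : 0 < FF (m, 2, k) (m, 1, k) (m', τ, k') ∨ (m', τ, k') = (m, (2 : Fin 4), k) ∨
      (m', τ, k') = (m, (1 : Fin 4), k) := by
    refine (F11 (i := (m, 2, k)) (j := (m, 1, k)) (l := (m', τ, k')) ?_ ?_).imp id fun e => ?_
    · simp [col] <;> omega
    · simp [yI] <;> ring
    · simp only [Prod.mk.injEq]
      fin_cases τ <;> simp [col, yI] at e ⊢ <;> split_ifs at e <;> omega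
  rcases key with h | h | h
  · exact Ok.of_pos h
  · rw [h]; exact Ok.left _ _
  · rw [h]; exact Ok.right _ _

lemma gab_qr (m k : ℕ) : Gab (m, 1, k) (m, 2, k + 1) := by
  rintro ⟨m', τ, k'⟩
  have key : 0 < FF (m, 1, k) (m, 2, k + 1) (m', τ, k') ∨ (m', τ, k') = (m, (1 : Fin 4), k) ∨
      (m', τ, k') = (m, (2 : Fin 4), k + 1) := by
    refine (F11 (i := (m, 1, k)) (j := (m, 2, k + 1)) (l := (m', τ, k')) ?_ ?_).imp id fun e => ?_
    · simp [col] <;> omega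
    · simp [yI] <;> ring
    · simp only [Prod.mk.injEq]
      fin_cases τ <;> simp [col, yI] at e ⊢ <;> split_ifs at e <;> omega
  rcases key with h | h | h
  · exact Ok.of_pos h
  · rw [h]; exact Ok.left _ _
  · rw [h]; exact Ok.right _ _

lemma gab_rs (m k : ℕ) : Gab (m, 2, k) (m, 3, k) := by
  rintro ⟨m', τ, k'⟩
  have key : 0 < FF (m, 2, k) (m, 3, k) (m', τ, k') ∨ (m', τ, k') = (m, (2 : Fin 4), k) ∨
      (m', τ, k') = (m, (3 : Fin 4), k) := by
    refine (F11 (i := (m, 2, k)) (j := (m, 3, k)) (l := (m', τ, k')) ?_ ?_).imp id fun e => ?_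
    · simp [col] <;> omega
    · simp [yI] <;> ring
    · simp only [Prod.mk.injEq]
      fin_cases τ <;> simp [col, yI] at e ⊢ <;> split_ifs at e <;> omega
  rcases key with h | h | h
  · exact Ok.of_pos h
  · rw [h]; exact Ok.left _ _
  · rw [h]; exact Ok.right _ _

lemma gab_sr (m k : ℕ) : Gab (m, 3, k) (m, 2, k + 1) := by
  rintro ⟨m', τ, k'⟩
  have key : 0 < FF (m, 3, k) (m, 2, k + 1) (m', τ, k') ∨ (m', τ, k') = (m, (3 : Fin 4), k) ∨
      (m', τ, k') = (m, (2 : Fin 4), k + 1) := by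
    refine (F11 (i := (m, 3, k)) (j := (m, 2, k + 1)) (l := (m', τ, k')) ?_ ?_).imp id fun e => ?_
    · simp [col] <;> omega
    · simp [yI] <;> ring
    · simp only [Prod.mk.injEq]
      fin_cases τ <;> simp [col, yI] at e ⊢ <;> split_ifs at e <;> omega
  rcases key with h | h | h
  · exact Ok.of_pos h
  · rw [h]; exact Ok.left _ _
  · rw [h]; exact Ok.right _ _

lemma gab_pr0 (m : ℕ) : Gab (m, 0, 0) (m, 2, 0) := by
  rintro ⟨m', τ, k'⟩
  have key : 0 < FF (m, 0, 0) (m, 2, 0) (m', τ, k') ∨ (m', τ, k') = (m, (0 : Fin 4), 0) ∨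
      (m', τ, k') = (m, (2 : Fin 4), 0) ∨
      (m', τ, k') = (m, (1 : Fin 4), 0) := by
    refine (F20 (i := (m, 0, 0)) (j := (m, 2, 0)) (l := (m', τ, k')) ?_ ?_).imp id fun e => ?_
    · simp [col] <;> omega
    · simp [yI] <;> ring
    · simp only [Prod.mk.injEq]
      fin_cases τ <;> simp [col, yI] at e ⊢ <;> split_ifs at e <;> omega
  rcases key with h | h | h | h
  · exact Ok.of_pos h
  · rw [h]; exact Ok.left _ _
  · rw [h]; exact Ok.right _ _
  · rw [h]; apply Ok.zone
    filter_upwards [zfacts 0] with t h1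
    exact h1.h1.ge

lemma gab_pr1 (m k : ℕ) : Gab (m, 0, k + 1) (m, 2, k + 1) := by
  rintro ⟨m', τ, k'⟩
  have key : 0 < FF (m, 0, k + 1) (m, 2, k + 1) (m', τ, k') ∨ (m', τ, k') = (m, (0 : Fin 4), k + 1) ∨
      (m', τ, k') = (m, (2 : Fin 4), k + 1) ∨
      (m', τ, k') = (m, (1 : Fin 4), k) ∨
      (m', τ, k') = (m, (1 : Fin 4), k + 1) := by
    refine (F20 (i := (m, 0, k + 1)) (j := (m, 2, k + 1)) (l := (m', τ, k')) ?_ ?_).imp id fun e => ?_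
    · simp [col] <;> omega
    · simp [yI] <;> ring
    · simp only [Prod.mk.injEq]
      fin_cases τ <;> simp [col, yI] at e ⊢ <;> split_ifs at e <;> omega
  rcases key with h | h | h | h | h
  · exact Ok.of_pos h
  · rw [h]; exact Ok.left _ _
  · rw [h]; exact Ok.right _ _
  · rw [h]; apply Ok.zone
    filter_upwards [zfacts k, zfacts (k + 1)] with t h1 h2
    have := h1.h3
    simp only [G, para, h1.hq, h1.hs] at *; linarith
  · rw [h]; apply Ok.zone
    filter_upwards [zfacts k, zfacts (k + 1)] with t h1 h2
    have := h1.h3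
    simp only [G, para, h1.hq, h1.hs] at *; linarith

lemma gab_qs (m k : ℕ) : Gab (m, 1, k) (m, 3, k) := by
  rintro ⟨m', τ, k'⟩
  have key : 0 < FF (m, 1, k) (m, 3, k) (m', τ, k') ∨ (m', τ, k') = (m, (1 : Fin 4), k) ∨
      (m', τ, k') = (m, (3 : Fin 4), k) ∨
      (m', τ, k') = (m, (2 : Fin 4), k) ∨
      (m', τ, k') = (m, (2 : Fin 4), k + 1) := by
    refine (F20 (i := (m, 1, k)) (j := (m, 3, k)) (l := (m', τ, k')) ?_ ?_).imp id fun e => ?_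
    · simp [col] <;> omega
    · simp [yI] <;> ring
    · simp only [Prod.mk.injEq]
      fin_cases τ <;> simp [col, yI] at e ⊢ <;> split_ifs at e <;> omega
  rcases key with h | h | h | h | h
  · exact Ok.of_pos h
  · rw [h]; exact Ok.left _ _
  · rw [h]; exact Ok.right _ _
  · rw [h]; apply Ok.zone
    filter_upwards [zfacts k, zfacts (k + 1)] with t h1 h2
    have := h1.h2
    simp only [G, para, h1.hq, h1.hs] at *; linarith
  · rw [h]; apply Ok.zone
    filter_upwards [zfacts k, zfacts (k + 1)] with t h1 h2
    have := h1.h2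
    simp only [G, para, h1.hq, h1.hs] at *; linarith

lemma gab_pr (m k : ℕ) : Gab (m, 0, k) (m, 2, k) := by
  cases k with
  | zero => exact gab_pr0 m
  | succ k => exact gab_pr1 m k

lemma gab_st0 (m k : ℕ) : Gab (m, wl m, k) (m + 1, wl m, k) := by
  rintro ⟨m', τ, k'⟩
  have key : 0 < FF (m, wl m, k) (m + 1, wl m, k) (m', τ, k') ∨ (m', τ, k') = (m, wl m, k) ∨
      (m', τ, k') = (m + 1, wl m, k) := by
    refine (F10 (i := (m, wl m, k)) (j := (m + 1, wl m, k)) (l := (m', τ, k')) ?_ ?_).imp id fun e => ?_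
    · rcases Nat.mod_two_eq_zero_or_one m with hm | hm <;> simp [col, wl, hm] <;> omega
    · simp [yI] <;> ring
    · simp only [Prod.mk.injEq]
      rcases Nat.mod_two_eq_zero_or_one m with hm | hm <;>
      fin_cases τ <;> simp [col, yI, wl, hm] at e ⊢ <;> split_ifs at e <;> omega
  rcases key with h | h | h
  · exact Ok.of_pos h
  · rw [h]; exact Ok.left _ _
  · rw [h]; exact Ok.right _ _

lemma gab_st1 (m k : ℕ) : Gab (m, wl m, k) (m + 1, wl m, k + 1) := by
  rintro ⟨m', τ, k'⟩
  have key : 0 < FF (m, wl m, k) (m + 1, wl m, k + 1) (m', τ, k') ∨ (m', τ, k') = (m, wl m, k) ∨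
      (m', τ, k') = (m + 1, wl m, k + 1) ∨
      (m', τ, k') = (m, wl m, k + 1) ∨
      (m', τ, k') = (m + 1, wl m, k) := by
    refine (F12 (i := (m, wl m, k)) (j := (m + 1, wl m, k + 1)) (l := (m', τ, k')) ?_ ?_).imp id fun e => ?_
    · rcases Nat.mod_two_eq_zero_or_one m with hm | hm <;> simp [col, wl, hm] <;> omega
    · simp [yI] <;> ring
    · simp only [Prod.mk.injEq]
      rcases Nat.mod_two_eq_zero_or_one m with hm | hm <;>
      fin_cases τ <;> simp [col, yI, wl, hm] at e ⊢ <;> split_ifs at e <;> omega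
  rcases key with h | h | h | h | h
  · exact Ok.of_pos h
  · rw [h]; exact Ok.left _ _
  · rw [h]; exact Ok.right _ _
  · rw [h]; exact strip1 m k (k + 1)
  · rw [h]; exact strip2 m k (k + 1)

lemma gab_st2 (m k : ℕ) : Gab (m + 1, wl m, k) (m, wl m, k + 1) := by
  rintro ⟨m', τ, k'⟩
  have key : 0 < FF (m + 1, wl m, k) (m, wl m, k + 1) (m', τ, k') ∨ (m', τ, k') = (m + 1, wl m, k) ∨
      (m', τ, k') = (m, wl m, k + 1) ∨
      (m', τ, k') = (m + 1, wl m, k + 1) ∨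
      (m', τ, k') = (m, wl m, k) := by
    refine (F12 (i := (m + 1, wl m, k)) (j := (m, wl m, k + 1)) (l := (m', τ, k')) ?_ ?_).imp id fun e => ?_
    · rcases Nat.mod_two_eq_zero_or_one m with hm | hm <;> simp [col, wl, hm] <;> omega
    · simp [yI] <;> ring
    · simp only [Prod.mk.injEq]
      rcases Nat.mod_two_eq_zero_or_one m with hm | hm <;>
      fin_cases τ <;> simp [col, yI, wl, hm] at e ⊢ <;> split_ifs at e <;> omega
  rcases key with h | h | h | h | h
  · exact Ok.of_pos h
  · rw [h]; exact Ok.left _ _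
  · rw [h]; exact Ok.right _ _
  · rw [h]; exact (strip2 m (k + 1) k).symm
  · rw [h]; exact (strip1 m (k + 1) k).symm

/-! ### Assembly -/

def sg {ι : Type} (v : ι → Euc 3) (x : Bool × ι) : Euc 3 := if x.1 then v x.2 else - v x.2

lemma fam_core {ι : Type} (I : Finset ι) (v : ι → Euc 3) (hn : ∀ i ∈ I, ‖v i‖ = 1)
    (hpos : ∀ i ∈ I, ∀ j ∈ I, 0 < ⟪v i, v j⟫) (hinj : ∀ i ∈ I, ∀ j ∈ I, v i = v j → i = j)
    (E : Finset (ι × ι))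
    (hE : ∀ e ∈ E, e.1 ∈ I ∧ e.2 ∈ I ∧ ∀ l ∈ I, 0 ≤ ⟪v l - v e.1, v l - v e.2⟫) :
    ∃ V : Finset (Euc 3), (∀ v ∈ V, ‖v‖ = 1) ∧ V.card = 2 * I.card ∧
      2 * E.card ≤ (dnF V).card := by
  have hn1 : ∀ i ∈ I, ⟪v i, v i⟫ = 1 := by
    intro i hi; rw [real_inner_self_eq_norm_sq, hn i hi]; norm_num
  have hne : ∀ i ∈ I, ∀ j ∈ I, v i ≠ - v j := by
    intro i hi j hj h
    have h1 := hpos i hi j hj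
    rw [h, inner_neg_left, hn1 j hj] at h1
    norm_num at h1
  have sinj : ∀ x y : Bool × ι, x.2 ∈ I → y.2 ∈ I → sg v x = sg v y → x = y := by
    rintro ⟨b, i⟩ ⟨b', j⟩ hi hj h
    cases b <;> cases b' <;> simp [sg] at h hi hj ⊢
    · exact hinj i hi j hj h
    · exact hne j hj i hi h.symm
    · exact hne i hi j hj h
    · exact hinj i hi j hj h
  have key : ∀ (b b' : Bool) (i j l : ι), i ∈ I → j ∈ I → l ∈ I →
      0 ≤ ⟪v l - v i, v l - v j⟫ →
      0 ≤ ⟪sg v (b', l) - sg v (b, i), sg v (!b, j) - sg v (b, i)⟫ := by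
    intro b b' i j l hi hj hl h
    have e1 := hn1 i hi
    have e2 := hn1 l hl
    have e3 := hpos l hl i hi
    have e4 := hpos l hl j hj
    have e5 := hpos i hi j hj
    have c1 := real_inner_comm (v i) (v l)
    simp only [inner_sub_left, inner_sub_right] at h
    cases b <;> cases b' <;>
      simp only [sg, Bool.not_true, Bool.not_false, if_true, Bool.false_eq_true, if_false,
        inner_sub_left, inner_sub_right, inner_neg_left, inner_neg_right] <;> linarith
  set V : Finset (Euc 3) := ((Finset.univ : Finset Bool) ×ˢ I).image (sg v) with hV
  refine ⟨V, ?_, ?_, ?_⟩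
  · intro w hw
    rw [hV, Finset.mem_image] at hw
    obtain ⟨⟨b, i⟩, hx, rfl⟩ := hw
    have hi : i ∈ I := by simpa using hx
    cases b <;> simp [sg, hn i hi]
  · rw [hV, Finset.card_image_of_injOn, Finset.card_product]
    · simp
    · intro x hx y hy h
      exact sinj x y (by simpa using hx) (by simpa using hy) h
  · have : 2 * E.card = ((Finset.univ : Finset Bool) ×ˢ E).card := by
      rw [Finset.card_product]; simp
    rw [this]
    apply Finset.card_le_card_of_injOn
      (fun x : Bool × (ι × ι) => (sg v (x.1, x.2.1), sg v (!x.1, x.2.2)))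
    · rintro ⟨b, i, j⟩ hx
      have hx' : (i, j) ∈ E := by simpa using hx
      obtain ⟨hi, hj, h⟩ := hE _ hx'
      simp only at hi hj h
      rw [Finset.mem_coe, mem_dnF]
      have mem : ∀ b i, i ∈ I → sg v (b, i) ∈ V := by
        intro b i hi; rw [hV]; apply Finset.mem_image_of_mem; simp [hi]
      refine ⟨mem _ _ hi, mem _ _ hj, ?_, ?_⟩
      · intro heq
        have := sinj (b, i) (!b, j) hi hj heq
        cases b <;> simp at this
      · intro w hw
        rw [hV, Finset.mem_image] at hw
        obtain ⟨⟨b', l⟩, hx, rfl⟩ := hw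
        have hl : l ∈ I := by simpa using hx
        refine ⟨key b b' i j l hi hj hl (h l hl), ?_⟩
        have h2 := key (!b) b' j i l hj hi hl (by rw [real_inner_comm]; exact h l hl)
        simpa using h2
    · rintro ⟨b, i, j⟩ hx ⟨b', i', j'⟩ hx' h
      have hx1 : (i, j) ∈ E := by simpa using hx
      have hx2 : (i', j') ∈ E := by simpa using hx'
      obtain ⟨hi, hj, -⟩ := hE _ hx1
      obtain ⟨hi', hj', -⟩ := hE _ hx2
      simp only [Prod.mk.injEq] at h
      have h1 := sinj _ _ hi hi' h.1
      have h2 := sinj _ _ hj hj' h.2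
      simp only [Prod.mk.injEq] at h1 h2 ⊢
      exact ⟨h1.1, h1.2, h2.2⟩

def vec (t : ℝ) (a : T3) : Euc 3 := !₂[√t * a.x, √t * a.y, 1 - t * a.h]

lemma vec_inner {t : ℝ} (ht : 0 < t) (a b : T3) :
    ⟪vec t a, vec t b⟫ = t * (a.x * b.x + a.y * b.y) + (1 - t * a.h) * (1 - t * b.h) := by
  have e := Real.mul_self_sqrt ht.le
  simp [vec, EuclideanSpace.inner_eq_star_dotProduct]
  linear_combination (a.x * b.x + a.y * b.y) * e

lemma vec_norm {t : ℝ} (ht : 0 < t) {a : T3} (h : OnQ t a) : ‖vec t a‖ = 1 := by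
  have : ‖vec t a‖ ^ 2 = 1 := by
    rw [← real_inner_self_eq_norm_sq, vec_inner ht]
    simp only [OnQ] at h
    linear_combination t * h
  have h0 := norm_nonneg (vec t a)
  nlinarith

lemma vec_G {t : ℝ} (ht : 0 < t) (i j l : T3) :
    ⟪vec t l - vec t i, vec t l - vec t j⟫ = t * G t i j l := by
  simp only [inner_sub_left, inner_sub_right, vec_inner ht, G]
  ring

lemma FF_pos {i j : Ix} (h : i ≠ j) : 0 < FF i i j := by
  obtain ⟨m, τ, k⟩ := i
  obtain ⟨m', τ', k'⟩ := j
  by_contra hc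
  apply h
  simp only [FF] at hc
  have h1 := mul_self_nonneg (col m' τ' - col m τ)
  have h2 := mul_self_nonneg (yI τ' k' - yI τ k)
  have h3 : col m' τ' - col m τ = 0 := mul_self_eq_zero.1 (by linarith)
  have h4 : yI τ' k' - yI τ k = 0 := mul_self_eq_zero.1 (by linarith)
  have b1 := τ.2
  have b2 := τ'.2
  have e : τ = τ' ∧ m = m' := by
    rw [Fin.ext_iff]
    simp only [col] at h3
    split_ifs at h3 <;> omega
  obtain ⟨rfl, rfl⟩ := e
  simp only [yI] at h4
  have : k = k' := by omega
  rw [this]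

lemma vec_ev (i j : Ix) : ∀ᶠ t in 𝓝[>] (0 : ℝ), 0 < ⟪vec t (Pos t i), vec t (Pos t j)⟫ := by
  have hi := Pos_lim i
  have hj := Pos_lim j
  have h := (tend_t.mul ((hi.1.mul hj.1).add (hi.2.1.mul hj.2.1))).add
    (((tend_t.mul hi.2.2).const_sub 1).mul ((tend_t.mul hj.2.2).const_sub 1))
  filter_upwards [h.eventually_const_lt (u := 0) (by norm_num), ev_pos_t] with t h1 h2
  rw [vec_inner h2]; exact h1

lemma dist_ev (i j : Ix) : ∀ᶠ t in 𝓝[>] (0 : ℝ),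
    (vec t (Pos t i) = vec t (Pos t j) → i = j) := by
  by_cases h : i = j
  · exact Eventually.of_forall fun _ _ => h
  · have h1 := (Pos_lim i).G (Pos_lim i) (Pos_lim j)
    have h2 : G 0 (fl0 i) (fl0 i) (fl0 j) = (FF i i j : ℝ) := by
      simp only [G, fl0_x, fl0_y, FF]; push_cast; ring
    rw [h2] at h1
    have h3 : (0 : ℝ) < (FF i i j : ℝ) := by exact_mod_cast FF_pos h
    filter_upwards [h1.eventually_const_lt h3, ev_pos_t] with t h4 h5 h6
    have := vec_G h5 (Pos t i) (Pos t i) (Pos t j)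
    rw [h6] at this
    simp at this
    rcases this with h | h <;> linarith

lemma gab_self (i : Ix) : Gab i i := by
  intro l
  filter_upwards [ev_pos_t] with t ht
  simp only [G]
  have := mul_nonneg ht.le (mul_self_nonneg ((Pos t l).h - (Pos t i).h))
  linarith [mul_self_nonneg ((Pos t l).x - (Pos t i).x),
    mul_self_nonneg ((Pos t l).y - (Pos t i).y)]

/-- offsets `(dm, type, dk)` of the edges attached to the cell `(m, k)` -/
def tb (w : Fin 4) : Fin 15 → Ix × Ix :=
  ![((0, 0, 0), (0, 0, 1)), ((0, 1, 0), (0, 1, 1)), ((0, 2, 0), (0, 2, 1)), ((0, 3, 0), (0, 3, 1)),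
    ((0, 0, 0), (0, 1, 0)), ((0, 1, 0), (0, 0, 1)), ((0, 2, 0), (0, 1, 0)), ((0, 1, 0), (0, 2, 1)),
    ((0, 2, 0), (0, 3, 0)), ((0, 3, 0), (0, 2, 1)), ((0, 0, 0), (0, 2, 0)), ((0, 1, 0), (0, 3, 0)),
    ((0, w, 0), (1, w, 0)), ((0, w, 0), (1, w, 1)), ((1, w, 0), (0, w, 1))]

abbrev EI := Fin 15 ⊕ Fin 15 ⊕ Fin 4

def tab (w : Fin 4) : EI → Ix × Ix
  | .inl e => tb w e
  | .inr (.inl e) => (tb w e).swap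
  | .inr (.inr τ) => ((0, τ, 0), (0, τ, 0))

def shf (m k : ℕ) (o : Ix) : Ix := (m + o.1, o.2.1, k + o.2.2)

set_option maxRecDepth 100000 in
lemma tab_inj : ∀ w : Fin 4, ∀ e e' : EI, tab w e = tab w e' → e = e' := by
  decide

lemma tab_bd : ∀ w : Fin 4, ∀ e : EI, (tab w e).1.1 ≤ 1 ∧ (tab w e).2.1 ≤ 1 ∧
    (tab w e).1.2.2 ≤ 1 ∧ (tab w e).2.2.2 ≤ 1 ∧ min (tab w e).1.1 (tab w e).2.1 = 0 ∧
    min (tab w e).1.2.2 (tab w e).2.2.2 = 0 := by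
  decide

lemma tb_gab (m k : ℕ) (e : Fin 15) :
    Gab (shf m k (tb (wl m) e).1) (shf m k (tb (wl m) e).2) := by
  fin_cases e
  · exact gab_pp m k
  · exact gab_qq m k
  · exact gab_rr m k
  · exact gab_ss m k
  · exact gab_pq m k
  · exact gab_qp m k
  · exact gab_rq m k
  · exact gab_qr m k
  · exact gab_rs m k
  · exact gab_sr m k
  · exact gab_pr m k
  · exact gab_qs m k
  · exact gab_st0 m k
  · exact gab_st1 m k
  · exact gab_st2 m k

lemma tab_gab (m k : ℕ) (e : EI) :
    Gab (shf m k (tab (wl m) e).1) (shf m k (tab (wl m) e).2) := by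
  rcases e with e | e | τ
  · exact tb_gab m k e
  · exact (tb_gab m k e).symm
  · exact gab_self _

lemma fam (K : ℕ) (hK : 1 ≤ K) : ∃ V : Finset (Euc 3), (∀ v ∈ V, ‖v‖ = 1) ∧
    V.card = 8 * K ^ 2 ∧ 68 * (K - 1) ^ 2 ≤ (dnF V).card := by
  set I : Finset Ix := Finset.range K ×ˢ (Finset.univ ×ˢ Finset.range K) with hI
  have memI : ∀ m τ k, (m, τ, k) ∈ I ↔ m < K ∧ k < K := by
    intro m τ k; simp [hI]
  have ev : ∀ᶠ t in 𝓝[>] (0 : ℝ), 0 < t ∧ (∀ i ∈ I, OnQ t (Pos t i)) ∧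
      (∀ i ∈ I, ∀ j ∈ I, 0 < ⟪vec t (Pos t i), vec t (Pos t j)⟫) ∧
      (∀ i ∈ I, ∀ j ∈ I, vec t (Pos t i) = vec t (Pos t j) → i = j) ∧
      (∀ i ∈ I, ∀ j ∈ I, ∀ l ∈ I, Gab i j → 0 ≤ G t (Pos t i) (Pos t j) (Pos t l)) := by
    simp only [eventually_and, eventually_all_finset]
    refine ⟨ev_pos_t, ?_, fun i _ j _ => vec_ev i j, fun i _ j _ => dist_ev i j, ?_⟩
    · intro i _
      filter_upwards [zfacts i.2.2, ev_pos_t] with t h1 h2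
      exact TT_on h2 _ (h1.on _)
    · intro i _ j _ l _
      by_cases h : Gab i j
      · exact (h l).mono fun t ht _ => ht
      · exact Eventually.of_forall fun t ht => absurd ht h
  obtain ⟨t, ht, h1, h2, h3, h4⟩ := ev.exists
  set f : ℕ × ℕ × EI → Ix × Ix := fun x =>
    (shf x.1 x.2.1 (tab (wl x.1) x.2.2).1, shf x.1 x.2.1 (tab (wl x.1) x.2.2).2) with hf
  set D : Finset (ℕ × ℕ × EI) :=
    Finset.range (K - 1) ×ˢ (Finset.range (K - 1) ×ˢ Finset.univ) with hD
  have finj : Function.Injective f := by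
    rintro ⟨m, k, e⟩ ⟨m', k', e'⟩ h
    have b := tab_bd (wl m) e
    have b' := tab_bd (wl m') e'
    simp only [hf, shf, Prod.mk.injEq] at h
    have hm : m = m' := by omega
    subst hm
    have hk : k = k' := by omega
    subst hk
    have he : tab (wl m) e = tab (wl m) e' := by
      refine Prod.ext (Prod.ext ?_ (Prod.ext ?_ ?_)) (Prod.ext ?_ (Prod.ext ?_ ?_))
      · omega
      · exact h.1.2.1
      · omega
      · omega
      · exact h.2.2.1
      · omega
    rw [tab_inj _ _ _ he]
  obtain ⟨V, v1, v2, v3⟩ := fam_core I (fun i => vec t (Pos t i)) (fun i hi => vec_norm ht (h1 i hi))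
    h2 h3 (D.image f) (by
      intro x hx
      rw [Finset.mem_image] at hx
      obtain ⟨⟨m, k, e⟩, hx, rfl⟩ := hx
      have b := tab_bd (wl m) e
      have hmk : m < K - 1 ∧ k < K - 1 := by simpa [hD] using hx
      have i1 : shf m k (tab (wl m) e).1 ∈ I := (memI _ _ _).2 ⟨by omega, by omega⟩
      have i2 : shf m k (tab (wl m) e).2 ∈ I := (memI _ _ _).2 ⟨by omega, by omega⟩
      refine ⟨i1, i2, fun l hl => ?_⟩
      rw [vec_G ht]
      exact mul_nonneg ht.le (h4 _ i1 _ i2 l hl (tab_gab m k e)))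
  refine ⟨V, v1, ?_, ?_⟩
  · rw [v2, hI]
    simp only [Finset.card_product, Finset.card_range, Finset.card_univ, Fintype.card_fin]
    ring
  · rw [Finset.card_image_of_injective _ finj, hD] at v3
    simp only [Finset.card_product, Finset.card_range, Finset.card_univ, Fintype.card_fin,
      Fintype.card_sum] at v3
    nlinarith

/-- There is a constant `C > 0` such that for every `n ≥ 4` there is a set of `n` points on
the unit sphere with at least `(17/4)n - C√n` double-normal pairs. -/
theorem doubleNormal_sphere_construction_asymptotic :
    ∃ C : ℝ, 0 < C ∧ ∀ n : ℕ, 4 ≤ n →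
      ∃ V : Finset (Euc 3), (∀ v ∈ V, ‖v‖ = 1) ∧ V.card = n ∧
        17 / 4 * (n : ℝ) - C * Real.sqrt n ≤ (numDN V : ℝ) := by
  exact main_of_family fam
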